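/- The annihilator Lie algebra of T_{utriv,m} = a₁⊗b₁⊗c₁ + Σ_{ρ=2}^m a₁⊗b_ρ⊗c_ρ + Σ_{ρ=2}^m a_ρ⊗b₁⊗c_ρ in gl_m ⊕ gl_m ⊕ gl_m has dimension (m−1)² − 1 + 2(m−1) + 3 = m² + 1; hence dim G_{T_{utriv,m}} = m² − 1. -/

import Mathlib

open scoped BigOperators

/-- Leibniz-rule action; its kernel is the annihilator `g̃_T` of `T`, and
`dim G_T = dim g̃_T − 2`. -/
noncomputable def tensorActionL (a b c : ℕ) (T : Fin a → Fin b → Fin c → ℂ) :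
    (Matrix (Fin a) (Fin a) ℂ × Matrix (Fin b) (Fin b) ℂ × Matrix (Fin c) (Fin c) ℂ) →ₗ[ℂ]
      (Fin a → Fin b → Fin c → ℂ) where
  toFun p := fun i j k =>
    (∑ i', p.1 i i' * T i' j k) + (∑ j', p.2.1 j j' * T i j' k) +
      (∑ k', p.2.2 k k' * T i j k')
  map_add' p q := by
    funext i j k
    simp only [Prod.fst_add, Prod.snd_add, Matrix.add_apply, add_mul,
      Finset.sum_add_distrib, Pi.add_apply]
    ring
  map_smul' t p := by
    funext i j k
    simp only [Prod.smul_fst, Prod.smul_snd, Matrix.smul_apply, smul_eq_mul,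
      RingHom.id_apply, Pi.smul_apply, Finset.mul_sum, mul_add, mul_assoc]


/-- The tensor `T_{utriv,m} = a₁⊗b₁⊗c₁ + Σ_{ρ≥2} a₁⊗b_ρ⊗c_ρ + Σ_{ρ≥2} a_ρ⊗b₁⊗c_ρ`. -/
noncomputable def Tutriv (m : ℕ) (hm : 1 ≤ m) : Fin m → Fin m → Fin m → ℂ :=
  fun i j k =>
    if (i = ⟨0, hm⟩ ∧ j = ⟨0, hm⟩ ∧ k = ⟨0, hm⟩) ∨
       (i = ⟨0, hm⟩ ∧ j ≠ ⟨0, hm⟩ ∧ k = j) ∨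
       (j = ⟨0, hm⟩ ∧ i ≠ ⟨0, hm⟩ ∧ k = i) then 1 else 0

section Tutriv

variable {m : ℕ} (hm : 1 ≤ m)

lemma Tutriv_zero_left (j k : Fin m) : Tutriv m hm ⟨0, hm⟩ j k = if k = j then 1 else 0 := by
  unfold Tutriv
  by_cases hj : j = ⟨0, hm⟩ <;> simp [hj]

lemma Tutriv_zero_mid (i k : Fin m) : Tutriv m hm i ⟨0, hm⟩ k = if k = i then 1 else 0 := by
  unfold Tutriv
  by_cases hi : i = ⟨0, hm⟩ <;> simp [hi]

lemma Tutriv_of_ne {i j : Fin m} (hi : i ≠ ⟨0, hm⟩) (hj : j ≠ ⟨0, hm⟩) (k : Fin m) :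
    Tutriv m hm i j k = 0 := by
  simp [Tutriv, hi, hj]

lemma sum_mul_Tutriv_left (v : Fin m → ℂ) {j : Fin m} (hj : j ≠ ⟨0, hm⟩) (k : Fin m) :
    ∑ i, v i * Tutriv m hm i j k = v ⟨0, hm⟩ * if k = j then 1 else 0 := by
  rw [Finset.sum_eq_single ⟨0, hm⟩, Tutriv_zero_left]
  · intro i _ hi
    rw [Tutriv_of_ne hm hi hj, mul_zero]
  · simp

lemma sum_mul_Tutriv_mid (v : Fin m → ℂ) {i : Fin m} (hi : i ≠ ⟨0, hm⟩) (k : Fin m) :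
    ∑ j, v j * Tutriv m hm i j k = v ⟨0, hm⟩ * if k = i then 1 else 0 := by
  rw [Finset.sum_eq_single ⟨0, hm⟩, Tutriv_zero_mid]
  · intro j _ hj
    rw [Tutriv_of_ne hm hi hj, mul_zero]
  · simp

/-- The linear equations cutting out the annihilator of `Tutriv`. -/
lemma mem_ker_tensorActionL_Tutriv_iff (A B C : Matrix (Fin m) (Fin m) ℂ) :
    (A, B, C) ∈ LinearMap.ker (tensorActionL m m m (Tutriv m hm)) ↔
      (∀ k, A ⟨0, hm⟩ k + B ⟨0, hm⟩ k + C k ⟨0, hm⟩ = 0) ∧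
      (∀ r, r ≠ ⟨0, hm⟩ → A r ⟨0, hm⟩ = 0 ∧ B r ⟨0, hm⟩ = 0 ∧ C ⟨0, hm⟩ r = 0) ∧
      (∀ r s, r ≠ ⟨0, hm⟩ → s ≠ ⟨0, hm⟩ →
        A r s + (if s = r then B ⟨0, hm⟩ ⟨0, hm⟩ else 0) + C s r = 0 ∧
        (if s = r then A ⟨0, hm⟩ ⟨0, hm⟩ else 0) + B r s + C s r = 0) := by
  have apply_eq (i j k : Fin m) : tensorActionL m m m (Tutriv m hm) (A, B, C) i j k =
      (∑ i', A i i' * Tutriv m hm i' j k) + (∑ j', B j j' * Tutriv m hm i j' k) +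
        (∑ k', C k k' * Tutriv m hm i j k') := rfl
  rw [LinearMap.mem_ker]
  constructor
  · intro h
    have h' (i j k : Fin m) := (apply_eq i j k).symm.trans (congrFun₃ h i j k)
    have h00 (k : Fin m) : A ⟨0, hm⟩ k + B ⟨0, hm⟩ k + C k ⟨0, hm⟩ = 0 := by
      simpa [Tutriv_zero_left, Tutriv_zero_mid] using h' ⟨0, hm⟩ ⟨0, hm⟩ k
    have h0r (r : Fin m) (hr : r ≠ ⟨0, hm⟩) (k : Fin m) :
        (if k = r then A ⟨0, hm⟩ ⟨0, hm⟩ else 0) + B r k + C k r = 0 := by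
      simpa [Tutriv_zero_left, sum_mul_Tutriv_left hm _ hr] using h' ⟨0, hm⟩ r k
    have hr0 (r : Fin m) (hr : r ≠ ⟨0, hm⟩) (k : Fin m) :
        A r k + (if k = r then B ⟨0, hm⟩ ⟨0, hm⟩ else 0) + C k r = 0 := by
      simpa [Tutriv_zero_mid, sum_mul_Tutriv_mid hm _ hr] using h' r ⟨0, hm⟩ k
    refine ⟨h00, fun r hr => ?_, fun r s hr _ => ⟨hr0 r hr s, h0r r hr s⟩⟩
    have hB : B r ⟨0, hm⟩ + C ⟨0, hm⟩ r = 0 := by simpa [hr.symm] using h0r r hr ⟨0, hm⟩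
    have hA : A r ⟨0, hm⟩ + C ⟨0, hm⟩ r = 0 := by simpa [hr.symm] using hr0 r hr ⟨0, hm⟩
    have hAB : A r ⟨0, hm⟩ + B r ⟨0, hm⟩ = 0 := by
      simpa [sum_mul_Tutriv_left hm _ hr, sum_mul_Tutriv_mid hm _ hr, Tutriv_of_ne hm hr hr]
        using h' r r r
    refine ⟨?_, ?_, ?_⟩
    · linear_combination (hA + hAB - hB) / 2
    · linear_combination (hB + hAB - hA) / 2
    · linear_combination (hA + hB - hAB) / 2
  · rintro ⟨h00, hz, hrs⟩
    funext i j k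
    rw [apply_eq]
    by_cases hi : i = ⟨0, hm⟩ <;> by_cases hj : j = ⟨0, hm⟩
    · subst hi hj
      simpa [Tutriv_zero_left, Tutriv_zero_mid] using h00 k
    · subst hi
      by_cases hk : k = ⟨0, hm⟩
      · subst hk
        simp [Tutriv_zero_left, sum_mul_Tutriv_left hm _ hj, hz j hj, Ne.symm hj]
      · simpa [Tutriv_zero_left, sum_mul_Tutriv_left hm _ hj] using (hrs j k hj hk).2
    · subst hj
      by_cases hk : k = ⟨0, hm⟩
      · subst hk
        simp [Tutriv_zero_mid, sum_mul_Tutriv_mid hm _ hi, hz i hi, Ne.symm hi]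
      · simpa [Tutriv_zero_mid, sum_mul_Tutriv_mid hm _ hi] using (hrs i k hi hk).1
    · simp [sum_mul_Tutriv_left hm _ hj, sum_mul_Tutriv_mid hm _ hi, Tutriv_of_ne hm hi hj,
        hz i hi, hz j hj]

/-- Coordinates on the annihilator of `Tutriv`: a triple `(A, B, C)` is recorded by the matrix
with zeroth row that of `A`, the rest of its zeroth column the zeroth row of `B`, and the remaining
block that of `C`, together with the corner entry of `B`. -/
noncomputable def annihilatorCoords :
    (Matrix (Fin m) (Fin m) ℂ × Matrix (Fin m) (Fin m) ℂ × Matrix (Fin m) (Fin m) ℂ) →ₗ[ℂ]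
      Matrix (Fin m) (Fin m) ℂ × ℂ where
  toFun p := (Matrix.of fun i j => if i = ⟨0, hm⟩ then p.1 i j else
    if j = ⟨0, hm⟩ then p.2.1 j i else p.2.2 i j, p.2.1 ⟨0, hm⟩ ⟨0, hm⟩)
  map_add' p q := by
    ext i j
    · simp only [Matrix.of_apply, Prod.fst_add, Prod.snd_add, Matrix.add_apply]
      split_ifs <;> rfl
    · rfl
  map_smul' t p := by
    ext i j
    · simp only [Matrix.of_apply, Prod.smul_fst, Prod.smul_snd, Matrix.smul_apply,
        RingHom.id_apply]
      split_ifs <;> rfl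
    · rfl

lemma annihilatorCoords_injOn_ker {p}
    (hp : p ∈ LinearMap.ker (tensorActionL m m m (Tutriv m hm)))
    (h0 : annihilatorCoords hm p = 0) : p = 0 := by
  obtain ⟨A, B, C⟩ := p
  obtain ⟨h00, hz, hrs⟩ := (mem_ker_tensorActionL_Tutriv_iff hm A B C).1 hp
  have hB0 : B ⟨0, hm⟩ ⟨0, hm⟩ = 0 := congrArg Prod.snd h0
  have hM (i j : Fin m) : (if i = ⟨0, hm⟩ then A i j else
      if j = ⟨0, hm⟩ then B j i else C i j) = 0 := congrFun₂ (congrArg Prod.fst h0) i j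
  have hA (j : Fin m) : A ⟨0, hm⟩ j = 0 := by simpa using hM ⟨0, hm⟩ j
  have hB (j : Fin m) : B ⟨0, hm⟩ j = 0 := by
    by_cases hj : j = ⟨0, hm⟩
    · rw [hj, hB0]
    · simpa [hj] using hM j ⟨0, hm⟩
  have hC (i j : Fin m) : C i j = 0 := by
    by_cases hj : j = ⟨0, hm⟩
    · subst hj
      simpa [hA, hB] using h00 i
    · by_cases hi : i = ⟨0, hm⟩
      · rw [hi, (hz j hj).2.2]
      · simpa [hi, hj] using hM i j
  refine Prod.ext ?_ (Prod.ext ?_ ?_) <;> ext i j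
  · by_cases hi : i = ⟨0, hm⟩
    · subst hi; exact hA j
    · by_cases hj : j = ⟨0, hm⟩
      · subst hj; exact (hz i hi).1
      · simpa [hB, hC] using (hrs i j hi hj).1
  · by_cases hi : i = ⟨0, hm⟩
    · subst hi; exact hB j
    · by_cases hj : j = ⟨0, hm⟩
      · subst hj; exact (hz i hi).2.1
      · simpa [hA, hC] using (hrs i j hi hj).2
  · exact hC i j

lemma exists_mem_ker_annihilatorCoords_eq (q : Matrix (Fin m) (Fin m) ℂ × ℂ) :
    ∃ p ∈ LinearMap.ker (tensorActionL m m m (Tutriv m hm)), annihilatorCoords hm p = q := by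
  obtain ⟨M, t⟩ := q
  let z : Fin m := ⟨0, hm⟩
  refine ⟨(Matrix.of fun i j => if i = z then M z j else if j = z then 0 else
      -((if j = i then t else 0) + M j i),
    Matrix.of fun i j => if i = z then (if j = z then t else M j z) else if j = z then 0 else
      -((if j = i then M z z else 0) + M j i),
    Matrix.of fun k l => if l = z then (if k = z then -(M z z + t) else -(M z k + M k z)) else
      if k = z then 0 else M k l), ?_, ?_⟩
  · rw [mem_ker_tensorActionL_Tutriv_iff]
    refine ⟨fun k => ?_, fun r hr => ?_, fun r s hr hs => ?_⟩
    · by_cases hk : k = z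
      · simp [hk, z]
      · simp [hk, z]
    · simp [hr, z]
    · simp only [Matrix.of_apply, z, hr, hs, if_true, if_false]
      constructor <;> ring
  · ext i j
    · by_cases hi : i = z <;> by_cases hj : j = z <;> simp_all [annihilatorCoords, z]
    · simp [annihilatorCoords, z]

lemma finrank_ker_tensorActionL_Tutriv :
    Module.finrank ℂ (LinearMap.ker (tensorActionL m m m (Tutriv m hm))) = m ^ 2 + 1 := by
  have hbij : Function.Bijective ((annihilatorCoords hm).domRestrict
      (LinearMap.ker (tensorActionL m m m (Tutriv m hm)))) := by
    refine ⟨(injective_iff_map_eq_zero _).2 fun p h =>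
      Subtype.ext (annihilatorCoords_injOn_ker hm p.2 h), fun q => ?_⟩
    obtain ⟨p, hp, h⟩ := exists_mem_ker_annihilatorCoords_eq hm q
    exact ⟨⟨p, hp⟩, h⟩
  rw [(LinearEquiv.ofBijective _ hbij).finrank_eq]
  simp [Module.finrank_matrix, sq]

end Tutriv

/-- The annihilator of `T_{utriv,m}` in `gl_m ⊕ gl_m ⊕ gl_m` has dimension
`(m−1)² − 1 + 2(m−1) + 3 = m² + 1`; hence `dim G_{T_{utriv,m}} = m² − 1`. -/
theorem annihilator_of_Tutriv (m : ℕ) (hm : 2 ≤ m) :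
    Module.finrank ℂ (LinearMap.ker (tensorActionL m m m (Tutriv m (by omega))))
      = (m - 1) ^ 2 - 1 + 2 * (m - 1) + 3 ∧
    Module.finrank ℂ (LinearMap.ker (tensorActionL m m m (Tutriv m (by omega)))) = m ^ 2 + 1 ∧
    Module.finrank ℂ (LinearMap.ker (tensorActionL m m m (Tutriv m (by omega)))) - 2
      = m ^ 2 - 1 := by
  rw [finrank_ker_tensorActionL_Tutriv]
  obtain ⟨n, rfl⟩ : ∃ n, m = n + 2 := ⟨m - 2, by omega⟩
  refine ⟨?_, rfl, by omega⟩
  have h : n + 2 - 1 = n + 1 := rfl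
  have hsq : (n + 1) ^ 2 - 1 = n ^ 2 + 2 * n := by
    rw [Nat.sub_eq_iff_eq_add (Nat.one_le_pow _ (n + 1) n.succ_pos)]
    ring
  rw [h, hsq]
  ring
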